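/- For every α ∈ (0,1), λ > 0 and real numbers 0 ≤ ξ < t, the following identity holds: (1/Γ(α)) ∫_ξ^t (t-s)^{α-1} (s-ξ)^{α-1} E_{α,α}(-λ (s-ξ)^α) ds = (1/λ) (t-ξ)^{α-1} ( 1/Γ(α) - E_{α,α}(-λ (t-ξ)^α) ). -/

import Mathlib

open MeasureTheory intervalIntegral

/-- The Mittag-Leffler function `E_{α,β}(z) = ∑_{k=0}^∞ z^k / Γ(α k + β)`. -/
noncomputable def mittagLeffler (α β z : ℝ) : ℝ :=
  ∑' k : ℕ, z ^ k / Real.Gamma (α * k + β)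

/-- A crude lower bound for the Gamma function, showing that it grows faster than every
exponential. -/
theorem rpow_mul_exp_neg_le_Gamma {R s : ℝ} (hR : 0 < R) (hs : 1 ≤ s) :
    R ^ (s - 1) * Real.exp (-R) ≤ Real.Gamma s := by
  have hint := Real.GammaIntegral_convergent (zero_lt_one.trans_le hs)
  have hsub : Set.Ioi R ⊆ Set.Ioi (0 : ℝ) := Set.Ioi_subset_Ioi hR.le
  rw [Real.Gamma_eq_integral (zero_lt_one.trans_le hs), ← integral_exp_neg_Ioi R,
    ← MeasureTheory.integral_const_mul]
  calc ∫ x in Set.Ioi R, R ^ (s - 1) * Real.exp (-x)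
      ≤ ∫ x in Set.Ioi R, Real.exp (-x) * x ^ (s - 1) := by
        refine setIntegral_mono_on ((exp_neg_integrableOn_Ioi R one_pos).congr_fun
          (fun x _ => by simp) measurableSet_Ioi |>.const_mul _)
          (hint.mono_set hsub) measurableSet_Ioi fun x hx => ?_
        rw [mul_comm]
        have : R ^ (s - 1) ≤ x ^ (s - 1) :=
          Real.rpow_le_rpow hR.le (le_of_lt hx) (by linarith)
        gcongr
    _ ≤ ∫ x in Set.Ioi 0, Real.exp (-x) * x ^ (s - 1) := by
        refine setIntegral_mono_set hint ?_ hsub.eventuallyLE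
        filter_upwards [self_mem_ae_restrict measurableSet_Ioi] with x hx
        exact mul_nonneg (Real.exp_pos _).le (Real.rpow_nonneg (le_of_lt hx) _)

/-- The Mittag-Leffler series converges everywhere. -/
theorem summable_mittagLeffler {α : ℝ} (hα : 0 < α) (β z : ℝ) :
    Summable fun k : ℕ => z ^ k / Real.Gamma (α * k + β) := by
  set R : ℝ := (2 * (|z| + 1)) ^ (1 / α) with hR
  have hz : 0 < |z| + 1 := by positivity
  have hRpos : 0 < R := by positivity
  have hRα : R ^ α = 2 * (|z| + 1) := by
    rw [hR, ← Real.rpow_mul (by positivity), one_div_mul_cancel hα.ne', Real.rpow_one]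
  refine Summable.of_norm_bounded_eventually_nat
    (g := fun k : ℕ => (R ^ (β - 1) * Real.exp (-R))⁻¹ * (1 / 2) ^ k)
    (summable_geometric_two.mul_left _) ?_
  have hlarge : ∀ᶠ k : ℕ in Filter.atTop, 1 ≤ α * k + β :=
    (Filter.tendsto_atTop_add_const_right _ β
      (tendsto_natCast_atTop_atTop.const_mul_atTop hα)).eventually_ge_atTop 1
  filter_upwards [hlarge] with k hk
  have hbound := rpow_mul_exp_neg_le_Gamma hRpos hk
  have hsplit : R ^ (α * k + β - 1) = (2 * (|z| + 1)) ^ k * R ^ (β - 1) := by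
    rw [add_sub_assoc, Real.rpow_add hRpos, Real.rpow_mul hRpos.le, hRα, Real.rpow_natCast]
  have hΓ : 0 < Real.Gamma (α * k + β) := Real.Gamma_pos_of_pos (by linarith)
  have hpow : |z| ^ k ≤ (|z| + 1) ^ k := by gcongr; linarith
  rw [norm_div, norm_pow, Real.norm_eq_abs, Real.norm_of_nonneg hΓ.le, div_le_iff₀ hΓ]
  calc |z| ^ k ≤ (|z| + 1) ^ k := hpow
    _ = (R ^ (β - 1) * Real.exp (-R))⁻¹ * (1 / 2) ^ k *
          (R ^ (α * k + β - 1) * Real.exp (-R)) := by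
        rw [hsplit, mul_pow, one_div, inv_pow]
        have := Real.exp_pos (-R)
        have := Real.rpow_pos_of_pos hRpos (β - 1)
        field_simp
    _ ≤ _ := by gcongr

theorem mittagLeffler_eq_add_mul {α : ℝ} (hα : 0 < α) (β z : ℝ) :
    mittagLeffler α β z = 1 / Real.Gamma β + z * mittagLeffler α (α + β) z := by
  rw [mittagLeffler, (summable_mittagLeffler hα β z).tsum_eq_zero_add, mittagLeffler,
    ← tsum_mul_left]
  congr 1
  · simp
  · refine tsum_congr fun k => ?_
    rw [pow_succ', mul_div_assoc]
    congr 3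
    push_cast
    ring

/-- The Euler beta integral over `[0, a]`. -/
theorem integral_rpow_mul_sub_rpow {u v a : ℝ} (hu : 0 < u) (hv : 0 < v) (ha : 0 < a) :
    ∫ x in (0 : ℝ)..a, x ^ (u - 1) * (a - x) ^ (v - 1) =
      a ^ (u + v - 1) * (Real.Gamma u * Real.Gamma v / Real.Gamma (u + v)) := by
  have h := Complex.betaIntegral_scaled u v ha
  rw [Complex.betaIntegral_eq_Gamma_mul_div u v (by simpa) (by simpa)] at h
  apply Complex.ofReal_injective
  rw [← intervalIntegral.integral_ofReal]
  push_cast [Complex.ofReal_cpow ha.le, ← Complex.Gamma_ofReal]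
  rw [← h]
  refine intervalIntegral.integral_congr fun x hx => ?_
  rw [Set.uIcc_of_le ha.le] at hx
  rw [Complex.ofReal_cpow hx.1, Complex.ofReal_cpow (sub_nonneg.2 hx.2)]
  push_cast
  rfl

theorem intervalIntegrable_rpow_mul_sub_rpow {u v a : ℝ} (hu : 0 < u) (hv : 0 < v)
    (ha : 0 < a) :
    IntervalIntegrable (fun x : ℝ => x ^ (u - 1) * (a - x) ^ (v - 1)) volume 0 a := by
  refine intervalIntegrable_of_integral_ne_zero ?_
  rw [integral_rpow_mul_sub_rpow hu hv ha]
  have := Real.Gamma_pos_of_pos hu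
  have := Real.Gamma_pos_of_pos hv
  have := Real.Gamma_pos_of_pos (add_pos hu hv)
  positivity

/-- The Riemann-Liouville fractional integral of order `γ` of `x ^ (β - 1) * E_{α,β}(c x ^ α)`. -/
theorem integral_rpow_mul_mittagLeffler {α β γ a : ℝ} (hα : 0 < α) (hβ : 0 < β) (hγ : 0 < γ)
    (ha : 0 < a) (c : ℝ) :
    ∫ x in (0 : ℝ)..a, (a - x) ^ (γ - 1) * x ^ (β - 1) * mittagLeffler α β (c * x ^ α) =
      Real.Gamma γ * a ^ (β + γ - 1) * mittagLeffler α (β + γ) (c * a ^ α) := by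
  have hpos (k : ℕ) : 0 < α * k + β := by positivity
  set B : ℕ → ℝ → ℝ := fun k x => x ^ (α * k + β - 1) * (a - x) ^ (γ - 1) with hB
  set F : ℕ → ℝ → ℝ := fun k x => c ^ k / Real.Gamma (α * k + β) * B k x with hF
  have hBint (k : ℕ) : IntegrableOn (B k) (Set.Ioc 0 a) :=
    (intervalIntegrable_iff_integrableOn_Ioc_of_le ha.le).1
      (intervalIntegrable_rpow_mul_sub_rpow (hpos k) hγ ha)
  have hcoef (b : ℝ) (k : ℕ) :
      b ^ k / Real.Gamma (α * k + β) * ∫ x in Set.Ioc 0 a, B k x =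
        Real.Gamma γ * a ^ (β + γ - 1) *
          ((b * a ^ α) ^ k / Real.Gamma (α * k + (β + γ))) := by
    rw [← intervalIntegral.integral_of_le ha.le, hB]
    simp only
    rw [integral_rpow_mul_sub_rpow (hpos k) hγ ha,
      show α * k + β + γ - 1 = α * k + (β + γ - 1) by ring, Real.rpow_add ha,
      Real.rpow_mul ha.le, Real.rpow_natCast, mul_pow, add_assoc]
    have := (Real.Gamma_pos_of_pos (hpos k)).ne'
    field_simp
  have hnorm (k : ℕ) : ∫ x in Set.Ioc 0 a, ‖F k x‖ =
      Real.Gamma γ * a ^ (β + γ - 1) *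
        ((|c| * a ^ α) ^ k / Real.Gamma (α * k + (β + γ))) := by
    rw [← hcoef, ← MeasureTheory.integral_const_mul]
    refine setIntegral_congr_fun measurableSet_Ioc fun x hx => ?_
    have hBx : 0 ≤ B k x :=
      mul_nonneg (Real.rpow_nonneg hx.1.le _) (Real.rpow_nonneg (sub_nonneg.2 hx.2) _)
    simp only [hF, norm_mul, norm_div, norm_pow, Real.norm_eq_abs, abs_of_nonneg hBx,
      abs_of_pos (Real.Gamma_pos_of_pos (hpos k))]
  have hsum := integral_tsum_of_summable_integral_norm
    (F := F) (μ := volume.restrict (Set.Ioc 0 a)) (fun k => (hBint k).const_mul _) (by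
      simp only [hnorm]
      exact (summable_mittagLeffler hα _ _).mul_left _)
  rw [intervalIntegral.integral_of_le ha.le]
  calc _ = ∫ x in Set.Ioc 0 a, ∑' k, F k x := by
        refine setIntegral_congr_fun measurableSet_Ioc fun x hx => ?_
        simp only [mittagLeffler]
        rw [← tsum_mul_left]
        refine tsum_congr fun k => ?_
        simp only [hF, hB]
        rw [add_sub_assoc, Real.rpow_add hx.1, Real.rpow_mul hx.1.le, Real.rpow_natCast, mul_pow]
        ring
    _ = ∑' k, ∫ x in Set.Ioc 0 a, F k x := hsum.symm
    _ = _ := by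
        rw [mittagLeffler, ← tsum_mul_left]
        refine tsum_congr fun k => ?_
        rw [← hcoef, ← MeasureTheory.integral_const_mul]

/-- For `α ∈ (0,1)`, `λ > 0` and `0 ≤ ξ < t`,
`(1/Γ(α)) ∫_ξ^t (t-s)^{α-1} (s-ξ)^{α-1} E_{α,α}(-λ (s-ξ)^α) ds
  = (1/λ) (t-ξ)^{α-1} (1/Γ(α) - E_{α,α}(-λ (t-ξ)^α))`. -/
theorem integral_mittagLeffler_convolution_identity
    (α lam ξ t : ℝ) (hα : α ∈ Set.Ioo (0:ℝ) 1) (hlam : 0 < lam)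
    (hξ : 0 ≤ ξ) (hξt : ξ < t) :
    (1 / Real.Gamma α) *
        ∫ s in ξ..t,
          (t - s) ^ (α - 1) * (s - ξ) ^ (α - 1) * mittagLeffler α α (-lam * (s - ξ) ^ α)
      = (1 / lam) * (t - ξ) ^ (α - 1) *
          (1 / Real.Gamma α - mittagLeffler α α (-lam * (t - ξ) ^ α)) := by
  obtain ⟨hα0, -⟩ := hα
  have ha : 0 < t - ξ := sub_pos.2 hξt
  have hshift := intervalIntegral.integral_comp_sub_right (a := ξ) (b := t)
    (fun x => (t - ξ - x) ^ (α - 1) * x ^ (α - 1) * mittagLeffler α α (-lam * x ^ α)) ξ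
  simp only [sub_sub_sub_cancel_right, sub_self] at hshift
  rw [hshift, integral_rpow_mul_mittagLeffler hα0 hα0 hα0 ha,
    mittagLeffler_eq_add_mul hα0 α, show α + α - 1 = (α - 1) + α by ring, Real.rpow_add ha]
  have := (Real.Gamma_pos_of_pos hα0).ne'
  field_simp
  ring
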